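/- Let ω_8 = e^1 ∧ (e^{23} + e^{57}) + e^6 ∧ (e^{27} + e^{45}) on F_q^7. Then X_1(ω_8) = P{x ≠ 0 : Pf_2(ι_x ω_8) = 0} = {x_1 = x_2 = x_5 = x_6 = 0, x_3 x_4 + x_7^2 = 0}, a smooth conic isomorphic to P^1 via (t,s) ↦ (0,0,t^2,−s^2,0,0,ts); in particular |X_1(ω_8)| = q + 1. -/

import Mathlib

open ExteriorAlgebra
open scoped LinearAlgebra.Projectivization

set_option synthInstance.maxHeartbeats 1000000
set_option maxHeartbeats 2000000

/-- Interior multiplication `ι_v` of a form (an element of the exterior algebra of the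
dual space) by a vector `v`, characterized by `⟨ι_v α, β⟩ = ⟨α, v ∧ β⟩`. -/
noncomputable def iMul (F : Type*) [Field F] {V : Type*} [AddCommGroup V] [Module F V] (v : V) :
    ExteriorAlgebra F (Module.Dual F V) →ₗ[F] ExteriorAlgebra F (Module.Dual F V) :=
  CliffordAlgebra.contractLeft (Module.Dual.eval F V v)

/-- The basic 1-form `e^i` (the `i`-th coordinate functional) as an element of the exterior
algebra of the dual space of `Fin n → F`. -/
noncomputable def ee (F : Type*) [Field F] {n : ℕ} (i : Fin n) :
    ExteriorAlgebra F (Module.Dual F (Fin n → F)) :=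
  ExteriorAlgebra.ι F (LinearMap.proj i)

section Contraction

variable {F : Type*} [Field F] {V : Type*} [AddCommGroup V] [Module F V]

theorem iMul_ι (v : V) (f : Module.Dual F V) :
    iMul F v (ι F f) = algebraMap F (ExteriorAlgebra F (Module.Dual F V)) (f v) :=
  CliffordAlgebra.contractLeft_ι (Q := (0 : QuadraticForm F (Module.Dual F V))) _ f

theorem iMul_ι_mul (v : V) (f : Module.Dual F V) (y : ExteriorAlgebra F (Module.Dual F V)) :
    iMul F v (ι F f * y) = f v • y - ι F f * iMul F v y :=
  CliffordAlgebra.contractLeft_ι_mul (Q := (0 : QuadraticForm F (Module.Dual F V))) _ f y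

theorem iMul_ι_mul_ι (v : V) (f g : Module.Dual F V) :
    iMul F v (ι F f * ι F g) = ι F (f v • g - g v • f) := by
  rw [iMul_ι_mul, iMul_ι, map_sub, map_smul, map_smul, Algebra.algebraMap_eq_smul_one,
    mul_smul_comm, mul_one]

theorem ι_mul_ι_comm (f g : Module.Dual F V) : ι F f * ι F g = -(ι F g * ι F f) :=
  eq_neg_of_add_eq_zero_left (ι_add_mul_swap f g)

/-- A decomposable 2-form `l` satisfies `ι_v l ∧ l = 0`. -/
theorem iMul_mul_self_of_decomposable (v : V) (f g : Module.Dual F V) :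
    iMul F v (ι F f * ι F g) * (ι F f * ι F g) = 0 := by
  rw [iMul_ι_mul_ι, map_sub, map_smul, map_smul, sub_mul, smul_mul_assoc, smul_mul_assoc,
    ← mul_assoc (ι F f) (ι F f), ι_sq_zero, zero_mul, smul_zero, sub_zero, ι_mul_ι_comm f g,
    mul_neg, ← mul_assoc, ι_sq_zero, zero_mul, neg_zero, smul_zero]

/-- The Plücker relations satisfied by the coefficients of a 2-form `l` with
`ι_v l ∧ l = 0` for all `v`. -/
theorem pluecker_of_iMul_mul_self {l : ExteriorAlgebra F (Module.Dual F V)}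
    {B : V → Module.Dual F V} (hB : ∀ v, iMul F v l = ι F (B v))
    (hl : ∀ v, iMul F v l * l = 0) (a b c d : V) :
    B d c * B b a - B d b * B c a + B c b * B d a = 0 := by
  have h : iMul F a (iMul F b (iMul F c (iMul F d l * l))) = 0 := by
    rw [hl, map_zero, map_zero, map_zero]
  rw [hB, iMul_ι_mul, hB, map_sub, map_smul, hB, iMul_ι_mul_ι, ← map_smul, ← map_sub, iMul_ι,
    ← map_zero (algebraMap F (ExteriorAlgebra F (Module.Dual F V))),
    ExteriorAlgebra.algebraMap_inj] at h
  simp only [LinearMap.sub_apply, LinearMap.smul_apply, smul_eq_mul] at h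
  linear_combination h

end Contraction

section Coordinates

variable {F : Type*} [Field F] {n : ℕ}

theorem iMul_single_prod_mul (i : Fin n) (β : ExteriorAlgebra F (Module.Dual F (Fin n → F)))
    (hβ : iMul F (Pi.single i 1) β = 0) (L : List (Fin n)) (hi : i ∉ L) :
    iMul F (Pi.single i 1) ((L.map (ee F)).prod * β) = 0 := by
  induction L with
  | nil => simpa using hβ
  | cons j L ih =>
    rw [List.mem_cons, not_or] at hi
    rw [List.map_cons, List.prod_cons, mul_assoc, ee, iMul_ι_mul, ih hi.2, mul_zero,
      LinearMap.proj_apply, Pi.single_eq_of_ne (Ne.symm hi.1), zero_smul, sub_zero]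

theorem eq_zero_of_prod_mul_eq_zero (β : ExteriorAlgebra F (Module.Dual F (Fin n → F)))
    (hβ : ∀ v, iMul F v β = 0) (L : List (Fin n)) (hL : L.Nodup)
    (h : (L.map (ee F)).prod * β = 0) : β = 0 := by
  induction L with
  | nil => simpa using h
  | cons i L ih =>
    rw [List.nodup_cons] at hL
    refine ih hL.2 ?_
    rw [List.map_cons, List.prod_cons, mul_assoc] at h
    have h' := iMul_ι_mul (Pi.single i 1) (LinearMap.proj i) ((L.map (ee F)).prod * β)
    rw [iMul_single_prod_mul i β (hβ _) L hL.1, mul_zero, sub_zero, LinearMap.proj_apply,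
      Pi.single_eq_same, one_smul] at h'
    rw [← h', ← ee, h, map_zero]

theorem exteriorPower_eq_bot {k : ℕ} (hk : n < k) :
    ⋀[F]^k (Module.Dual F (Fin n → F)) = ⊥ := by
  rw [← ιMulti_span_fixedDegree, Submodule.span_eq_bot]
  rintro _ ⟨m, rfl⟩
  refine AlternatingMap.map_linearDependent _ _ fun hm => ?_
  have := hm.fintype_card_le_finrank
  rw [Fintype.card_fin, Subspace.dual_finrank_eq, Module.finrank_fin_fun] at this
  omega

/-- A form of positive degree all of whose contractions vanish is zero. -/
theorem eq_zero_of_iMul_eq_zero {k : ℕ} (hk : 1 ≤ k)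
    {β : ExteriorAlgebra F (Module.Dual F (Fin n → F))}
    (hmem : β ∈ ⋀[F]^k (Module.Dual F (Fin n → F))) (hβ : ∀ v, iMul F v β = 0) : β = 0 := by
  refine eq_zero_of_prod_mul_eq_zero β hβ (List.finRange n) (List.nodup_finRange n) ?_
  have hprod : ∀ L : List (Fin n),
      (L.map (ee F)).prod ∈ ⋀[F]^L.length (Module.Dual F (Fin n → F)) := by
    intro L
    induction L with
    | nil => simp
    | cons i L ih =>
      rw [List.map_cons, List.prod_cons, List.length_cons, exteriorPower, pow_succ']
      exact Submodule.mul_mem_mul ⟨_, rfl⟩ ih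
  have h := Submodule.mul_mem_mul (hprod (List.finRange n)) hmem
  rw [exteriorPower, exteriorPower, ← pow_add, List.length_finRange] at h
  rw [← exteriorPower, exteriorPower_eq_bot (by omega)] at h
  exact (Submodule.mem_bot F).mp h

theorem ee_mul_ee_mem (i j : Fin n) :
    ee F i * ee F j ∈ ⋀[F]^2 (Module.Dual F (Fin n → F)) := by
  rw [exteriorPower, pow_two]
  exact Submodule.mul_mem_mul ⟨_, rfl⟩ ⟨_, rfl⟩

/-- The second Pfaffian of a 2-form `l` vanishes iff `ι_v l ∧ l = 0` for all `v`. -/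
theorem pf_two_eq_zero_iff
    {Pf : ExteriorAlgebra F (Module.Dual F (Fin n → F)) → ℕ →
      ExteriorAlgebra F (Module.Dual F (Fin n → F))}
    (hPf0 : ∀ l, Pf l 0 = 1)
    (hPfmem : ∀ l ∈ ⋀[F]^2 (Module.Dual F (Fin n → F)), ∀ k : ℕ, 1 ≤ k →
      Pf l k ∈ ⋀[F]^(2 * k) (Module.Dual F (Fin n → F)))
    (hPf : ∀ l ∈ ⋀[F]^2 (Module.Dual F (Fin n → F)), ∀ (k : ℕ) (v : Fin n → F),
      iMul F v (Pf l (k + 1)) = iMul F v l * Pf l k)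
    {l : ExteriorAlgebra F (Module.Dual F (Fin n → F))}
    (hl : l ∈ ⋀[F]^2 (Module.Dual F (Fin n → F))) :
    Pf l 2 = 0 ↔ ∀ v, iMul F v l * l = 0 := by
  have h1 : Pf l 1 = l := by
    refine sub_eq_zero.mp (eq_zero_of_iMul_eq_zero one_le_two
      (Submodule.sub_mem _ (hPfmem l hl 1 le_rfl) hl) fun v => ?_)
    rw [map_sub, hPf l hl 0, hPf0, mul_one, sub_self]
  have h2 : ∀ v, iMul F v (Pf l 2) = iMul F v l * l := fun v => by
    rw [hPf l hl 1, h1]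
  constructor
  · intro h v
    rw [← h2, h, map_zero]
  · intro h
    exact eq_zero_of_iMul_eq_zero (by norm_num) (hPfmem l hl 2 one_le_two)
      fun v => (h2 v).trans (h v)

end Coordinates

section Conic

variable {F : Type*} [Field F]

theorem iMul_omega8 (x : Fin 7 → F) :
    iMul F x (ee F 0 * (ee F 1 * ee F 2 + ee F 4 * ee F 6)
      + ee F 5 * (ee F 1 * ee F 6 + ee F 3 * ee F 4)) =
    x 0 • (ee F 1 * ee F 2 + ee F 4 * ee F 6) + x 5 • (ee F 1 * ee F 6 + ee F 3 * ee F 4)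
    - x 1 • (ee F 0 * ee F 2) + x 2 • (ee F 0 * ee F 1)
    - x 4 • (ee F 0 * ee F 6) + x 6 • (ee F 0 * ee F 4)
    - x 1 • (ee F 5 * ee F 6) + x 6 • (ee F 5 * ee F 1)
    - x 3 • (ee F 5 * ee F 4) + x 4 • (ee F 5 * ee F 3) := by
  simp only [ee, map_add, iMul_ι_mul, iMul_ι, Algebra.algebraMap_eq_smul_one,
    LinearMap.proj_apply, mul_add, mul_sub, mul_smul_comm, mul_one]
  module

theorem iMul_omega8_mem (x : Fin 7 → F) :
    iMul F x (ee F 0 * (ee F 1 * ee F 2 + ee F 4 * ee F 6)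
      + ee F 5 * (ee F 1 * ee F 6 + ee F 3 * ee F 4)) ∈
    ⋀[F]^2 (Module.Dual F (Fin 7 → F)) := by
  rw [iMul_omega8]
  have h (i j : Fin 7) := ee_mul_ee_mem (F := F) i j
  have hs (c : F) (i j : Fin 7) := Submodule.smul_mem _ c (h i j)
  exact add_mem (sub_mem (add_mem (sub_mem (add_mem (sub_mem (add_mem (sub_mem (add_mem
    (Submodule.smul_mem _ _ (add_mem (h _ _) (h _ _)))
    (Submodule.smul_mem _ _ (add_mem (h _ _) (h _ _)))) (hs _ _ _)) (hs _ _ _)) (hs _ _ _))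
    (hs _ _ _)) (hs _ _ _)) (hs _ _ _)) (hs _ _ _)) (hs _ _ _)

/-- A solution of the equations of the conic is a multiple of a point of the parametrization. -/
theorem exists_param {v : Fin 7 → F} (hv : v ≠ 0) (h0 : v 0 = 0) (h1 : v 1 = 0) (h4 : v 4 = 0)
    (h5 : v 5 = 0) (h : v 2 * v 3 + v 6 ^ 2 = 0) :
    ∃ c t s : F, c ≠ 0 ∧ v = c • ![0, 0, t ^ 2, -(s ^ 2), 0, 0, t * s] := by
  by_cases h2 : v 2 = 0
  · have h6 : v 6 = 0 := by simpa [h2] using h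
    have h3 : v 3 ≠ 0 := fun h3 => hv <| by
      ext i
      fin_cases i <;> simp [*]
    refine ⟨-v 3, 0, 1, neg_ne_zero.mpr h3, ?_⟩
    ext i
    fin_cases i <;> simp [*]
  · refine ⟨(v 2)⁻¹, v 2, v 6, inv_ne_zero h2, ?_⟩
    ext i
    fin_cases i <;> simp [*]
    · field_simp
    · field_simp
      linear_combination h

theorem iMul_omega8_pluecker_iff {x : Fin 7 → F} (hx : x ≠ 0) :
    (∀ v, iMul F v (iMul F x (ee F 0 * (ee F 1 * ee F 2 + ee F 4 * ee F 6)
      + ee F 5 * (ee F 1 * ee F 6 + ee F 3 * ee F 4))) *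
      iMul F x (ee F 0 * (ee F 1 * ee F 2 + ee F 4 * ee F 6)
      + ee F 5 * (ee F 1 * ee F 6 + ee F 3 * ee F 4)) = 0) ↔
    x 0 = 0 ∧ x 1 = 0 ∧ x 4 = 0 ∧ x 5 = 0 ∧ x 2 * x 3 + x 6 ^ 2 = 0 := by
  constructor
  · intro h
    let e (i j : Fin 7) (v : Fin 7 → F) : Module.Dual F (Fin 7 → F) :=
      v i • LinearMap.proj j - v j • LinearMap.proj i
    have P := pluecker_of_iMul_mul_self (B := fun v =>
      x 0 • (e 1 2 v + e 4 6 v) + x 5 • (e 1 6 v + e 3 4 v)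
      - x 1 • e 0 2 v + x 2 • e 0 1 v - x 4 • e 0 6 v + x 6 • e 0 4 v
      - x 1 • e 5 6 v + x 6 • e 5 1 v - x 3 • e 5 4 v + x 4 • e 5 3 v) (fun v => by
        rw [iMul_omega8]
        simp only [ee, e, map_add, map_sub, map_smul, iMul_ι_mul_ι,
          LinearMap.proj_apply]) h
    have Q (a b c d : Fin 7) :=
      P (Pi.single a 1) (Pi.single b 1) (Pi.single c 1) (Pi.single d 1)
    have h0 : x 0 = 0 := by simpa [e, Pi.single_apply] using Q 1 2 4 6
    have h5 : x 5 = 0 := by simpa [e, Pi.single_apply] using Q 1 6 3 4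
    have h1 : x 1 = 0 := by simpa [e, Pi.single_apply, h0, h5] using Q 0 2 5 6
    have h4 : x 4 = 0 := by simpa [e, Pi.single_apply, h0, h5, h1] using Q 0 6 5 3
    refine ⟨h0, h1, h4, h5, ?_⟩
    have := Q 0 1 5 4
    simp [e, h0, h5, h1, h4] at this
    linear_combination -this
  · rintro ⟨h0, h1, h4, h5, h⟩ v
    obtain ⟨c, t, s, -, rfl⟩ := exists_param hx h0 h1 h4 h5 h
    have key : iMul F (c • ![0, 0, t ^ 2, -(s ^ 2), 0, 0, t * s])
        (ee F 0 * (ee F 1 * ee F 2 + ee F 4 * ee F 6)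
          + ee F 5 * (ee F 1 * ee F 6 + ee F 3 * ee F 4)) =
        ι F (c • (t • LinearMap.proj 0 + s • LinearMap.proj 5)) *
          ι F (t • LinearMap.proj 1 + s • LinearMap.proj 4) := by
      rw [iMul_omega8]
      simp [ee, add_mul, mul_add]
      module
    rw [key]
    exact iMul_mul_self_of_decomposable v _ _

theorem card_conic [Fintype F] :
    Nat.card ↥{p : ℙ F (Fin 7 → F) | ∃ t s : F,
        ∃ h : (![0, 0, t ^ 2, -(s ^ 2), 0, 0, t * s] : Fin 7 → F) ≠ 0,
        p = Projectivization.mk F ![0, 0, t ^ 2, -(s ^ 2), 0, 0, t * s] h} =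
      Fintype.card F + 1 := by
  have hs (s : F) : (![0, 0, 1 ^ 2, -(s ^ 2), 0, 0, 1 * s] : Fin 7 → F) ≠ 0 := fun h => by
    simpa using congrFun h 2
  have hinf : (![0, 0, 0 ^ 2, -(1 ^ 2), 0, 0, 0 * 1] : Fin 7 → F) ≠ 0 := fun h => by
    simpa using congrFun h 3
  let f : Option F → ↥{p : ℙ F (Fin 7 → F) | ∃ t s : F,
        ∃ h : (![0, 0, t ^ 2, -(s ^ 2), 0, 0, t * s] : Fin 7 → F) ≠ 0,
        p = Projectivization.mk F ![0, 0, t ^ 2, -(s ^ 2), 0, 0, t * s] h} := fun o =>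
    o.elim ⟨_, 0, 1, hinf, rfl⟩ fun s => ⟨_, 1, s, hs s, rfl⟩
  have hf : Function.Bijective f := by
    constructor
    · rintro (_ | s) (_ | s') h
      · rfl
      · obtain ⟨a, ha⟩ := (Projectivization.mk_eq_mk_iff' F _ _ _ _).mp (congrArg Subtype.val h)
        have h2 := congrFun ha 2
        have h3 := congrFun ha 3
        simp at h2 h3
        simp [h2] at h3
      · obtain ⟨a, ha⟩ := (Projectivization.mk_eq_mk_iff' F _ _ _ _).mp (congrArg Subtype.val h)
        simpa using congrFun ha 2
      · obtain ⟨a, ha⟩ := (Projectivization.mk_eq_mk_iff' F _ _ _ _).mp (congrArg Subtype.val h)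
        have h2 := congrFun ha 2
        have h6 := congrFun ha 6
        simp at h2 h6
        rw [← h6, h2, one_mul]
    · rintro ⟨_, t, s, h, rfl⟩
      by_cases ht : t = 0
      · subst ht
        have hs0 : s ≠ 0 := by
          rintro rfl
          refine h ?_
          ext i
          fin_cases i <;> simp
        refine ⟨none, Subtype.ext ((Projectivization.mk_eq_mk_iff' F _ _ _ _).mpr
          ⟨(s ^ 2)⁻¹, ?_⟩)⟩
        ext i
        fin_cases i <;> simp [hs0]
      · refine ⟨some (s / t), Subtype.ext ((Projectivization.mk_eq_mk_iff' F _ _ _ _).mpr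
          ⟨(t ^ 2)⁻¹, ?_⟩)⟩
        ext i
        fin_cases i <;> simp [ht] <;> field_simp
  rw [← Nat.card_eq_of_bijective f hf, Nat.card_eq_fintype_card, Fintype.card_option]

end Conic

/-- For `ω₈ = e¹ ∧ (e²³ + e⁵⁷) + e⁶ ∧ (e²⁷ + e⁴⁵)` on `F_q^7`, the weight
variety `X₁(ω₈) = P{x ≠ 0 : Pf₂(ι_x ω₈) = 0}` equals
`{x₁ = x₂ = x₅ = x₆ = 0, x₃x₄ + x₇² = 0}`, a smooth conic isomorphic to `P¹` via
`(t,s) ↦ (0,0,t²,−s²,0,0,ts)`; in particular `|X₁(ω₈)| = q + 1`. -/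
theorem X1_omega8 (F : Type*) [Field F] [Fintype F] (q : ℕ) (hq : Fintype.card F = q)
    (Pf : ExteriorAlgebra F (Module.Dual F (Fin 7 → F)) → ℕ →
      ExteriorAlgebra F (Module.Dual F (Fin 7 → F)))
    (hPf0 : ∀ l, Pf l 0 = 1)
    (hPfmem : ∀ l ∈ ⋀[F]^2 (Module.Dual F (Fin 7 → F)), ∀ k : ℕ, 1 ≤ k →
      Pf l k ∈ ⋀[F]^(2 * k) (Module.Dual F (Fin 7 → F)))
    (hPf : ∀ l ∈ ⋀[F]^2 (Module.Dual F (Fin 7 → F)), ∀ (k : ℕ) (v : Fin 7 → F),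
      iMul F v (Pf l (k + 1)) = iMul F v l * Pf l k)
    (ω : ExteriorAlgebra F (Module.Dual F (Fin 7 → F)))
    (hω : ω = ee F 0 * (ee F 1 * ee F 2 + ee F 4 * ee F 6)
      + ee F 5 * (ee F 1 * ee F 6 + ee F 3 * ee F 4))
    (X : Set (ℙ F (Fin 7 → F)))
    (hX : X = {p | ∃ v, ∃ hv : v ≠ 0, p = Projectivization.mk F v hv ∧
      Pf (iMul F v ω) 2 = 0}) :
    X = {p | ∃ v, ∃ hv : v ≠ 0, p = Projectivization.mk F v hv ∧
        v 0 = 0 ∧ v 1 = 0 ∧ v 4 = 0 ∧ v 5 = 0 ∧ v 2 * v 3 + v 6 ^ 2 = 0} ∧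
      (X = {p | ∃ t s : F,
        ∃ h : (![0, 0, t ^ 2, -(s ^ 2), 0, 0, t * s] : Fin 7 → F) ≠ 0,
        p = Projectivization.mk F ![0, 0, t ^ 2, -(s ^ 2), 0, 0, t * s] h}) ∧
      Nat.card ↥X = q + 1 := by
  have hX1 : X = {p | ∃ v, ∃ hv : v ≠ 0, p = Projectivization.mk F v hv ∧
      v 0 = 0 ∧ v 1 = 0 ∧ v 4 = 0 ∧ v 5 = 0 ∧ v 2 * v 3 + v 6 ^ 2 = 0} := by
    rw [hX]
    ext p
    refine exists_congr fun v => exists_congr fun hv => and_congr_right fun _ => ?_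
    rw [hω, pf_two_eq_zero_iff hPf0 hPfmem hPf (iMul_omega8_mem v), iMul_omega8_pluecker_iff hv]
  have hX2 : X = {p | ∃ t s : F,
      ∃ h : (![0, 0, t ^ 2, -(s ^ 2), 0, 0, t * s] : Fin 7 → F) ≠ 0,
      p = Projectivization.mk F ![0, 0, t ^ 2, -(s ^ 2), 0, 0, t * s] h} := by
    rw [hX1]
    ext p
    constructor
    · rintro ⟨v, hv, rfl, h0, h1, h4, h5, h⟩
      obtain ⟨c, t, s, -, hc⟩ := exists_param hv h0 h1 h4 h5 h
      refine ⟨t, s, fun h0 => hv (by rw [hc, h0, smul_zero]), ?_⟩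
      exact (Projectivization.mk_eq_mk_iff' F _ _ _ _).mpr ⟨c, hc.symm⟩
    · rintro ⟨t, s, h, rfl⟩
      refine ⟨_, h, rfl, rfl, rfl, rfl, rfl, ?_⟩
      simp
      ring
  exact ⟨hX1, hX2, by rw [hX2, card_conic, hq]⟩
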